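/- Suppose the log-likelihood satisfies sup_{x,x' ∈ 𝒳, θ ∈ Θ} |log f(x',θ) − log f(x,θ)| ≤ Δ for a finite constant Δ, and let T > 0. Define the tempered posterior μ_{X,T} as the probability measure on Θ with density θ ↦ (∏_{i=1}^N f(x_i,θ))^{1/T}/Z_{X,T} with respect to the prior π, where Z_{X,T} = ∫_Θ (∏_{i=1}^N f(x_i,θ))^{1/T} dπ(θ) is assumed positive and finite. Then releasing one sample from the tempered posterior at temperature T = 2Δ/ε is ε-differentially private: for any neighboring datasets X, X' and any measurable S ⊆ Θ, μ_{X,T}(S) ≤ exp(2Δ/T) · μ_{X',T}(S). -/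

import Mathlib

open MeasureTheory ENNReal

/-- Changing one entry of a dataset changes the tempered likelihood by a factor of at most
`exp (Δ / T)`. -/
lemma tempered_likelihood_le {𝒳 Θ : Type*} {f : 𝒳 → Θ → ℝ} (hf_pos : ∀ x θ, 0 < f x θ)
    {Δ T : ℝ} (hT : 0 ≤ T)
    (hΔ : ∀ x x' θ, |Real.log (f x' θ) - Real.log (f x θ)| ≤ Δ)
    {N : ℕ} {X X' : Fin N → 𝒳} {j : Fin N} (hX : ∀ i, i ≠ j → X i = X' i) (θ : Θ) :
    (∏ i, f (X i) θ) ^ (1 / T) ≤ Real.exp (Δ / T) * (∏ i, f (X' i) θ) ^ (1 / T) := by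
  have entry : f (X j) θ ≤ Real.exp Δ * f (X' j) θ := by
    rw [← Real.log_le_log_iff (hf_pos _ _) (mul_pos (Real.exp_pos _) (hf_pos _ _)),
      Real.log_mul (Real.exp_ne_zero _) (hf_pos _ _).ne', Real.log_exp]
    linarith [le_abs_self (Real.log (f (X j) θ) - Real.log (f (X' j) θ)), hΔ (X' j) (X j) θ]
  have prod_le : ∏ i, f (X i) θ ≤ Real.exp Δ * ∏ i, f (X' i) θ := by
    rw [← Finset.mul_prod_erase _ _ (Finset.mem_univ j),
      ← Finset.mul_prod_erase _ (fun i => f (X' i) θ) (Finset.mem_univ j), ← mul_assoc,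
      Finset.prod_congr rfl fun i hi => by rw [hX i (Finset.ne_of_mem_erase hi)]]
    exact mul_le_mul_of_nonneg_right entry (Finset.prod_nonneg fun i _ => (hf_pos _ _).le)
  calc (∏ i, f (X i) θ) ^ (1 / T)
      ≤ (Real.exp Δ * ∏ i, f (X' i) θ) ^ (1 / T) :=
        Real.rpow_le_rpow (Finset.prod_nonneg fun i _ => (hf_pos _ _).le) prod_le (by positivity)
    _ = Real.exp (Δ / T) * (∏ i, f (X' i) θ) ^ (1 / T) := by
        rw [Real.mul_rpow (Real.exp_pos _).le (Finset.prod_nonneg fun i _ => (hf_pos _ _).le),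
          ← Real.exp_mul, mul_one_div]

/-- The integrated form of `tempered_likelihood_le`. -/
lemma lintegral_tempered_likelihood_le {𝒳 Θ : Type*} [MeasurableSpace Θ] (μ : Measure Θ)
    {f : 𝒳 → Θ → ℝ} (hf_pos : ∀ x θ, 0 < f x θ) {Δ T : ℝ} (hT : 0 ≤ T)
    (hΔ : ∀ x x' θ, |Real.log (f x' θ) - Real.log (f x θ)| ≤ Δ)
    {N : ℕ} {X X' : Fin N → 𝒳} {j : Fin N} (hX : ∀ i, i ≠ j → X i = X' i) :
    ∫⁻ θ, ENNReal.ofReal ((∏ i, f (X i) θ) ^ (1 / T)) ∂μ ≤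
      ENNReal.ofReal (Real.exp (Δ / T)) *
        ∫⁻ θ, ENNReal.ofReal ((∏ i, f (X' i) θ) ^ (1 / T)) ∂μ := by
  rw [← lintegral_const_mul' _ _ ENNReal.ofReal_ne_top]
  refine lintegral_mono fun θ => ?_
  rw [← ENNReal.ofReal_mul (Real.exp_pos _).le]
  exact ENNReal.ofReal_le_ofReal (tempered_likelihood_le hf_pos hT hΔ hX θ)

lemma ENNReal.div_le_mul_mul_div {a a' z z' c : ℝ≥0∞} (hc : c ≠ 0) (hc' : c ≠ ⊤)
    (ha : a ≤ c * a') (hz : z' ≤ c * z) : a / z ≤ c * c * (a' / z') := by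
  have inv_le : z⁻¹ ≤ c * z'⁻¹ := by
    calc z⁻¹ = c * (c * z)⁻¹ := by
          rw [ENNReal.mul_inv (Or.inl hc) (Or.inl hc'), ← mul_assoc,
            ENNReal.mul_inv_cancel hc hc', one_mul]
      _ ≤ c * z'⁻¹ := by gcongr
  calc a / z = a * z⁻¹ := div_eq_mul_inv _ _
    _ ≤ (c * a') * (c * z'⁻¹) := mul_le_mul' ha inv_le
    _ = c * c * (a' / z') := by rw [div_eq_mul_inv]; ring

/-- Releasing one sample from the tempered posterior (density `(∏ᵢ f(xᵢ,θ))^{1/T}` w.r.t.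
the prior) at temperature `T = 2Δ/ε` is `ε = 2Δ/T`-differentially private. -/
theorem tempered_posterior_sample_dp
    {𝒳 Θ : Type*} [MeasurableSpace 𝒳] [MeasurableSpace Θ]
    (π : Measure Θ) [IsProbabilityMeasure π]
    (f : 𝒳 → Θ → ℝ)
    (hf_pos : ∀ x θ, 0 < f x θ)
    (hf_meas : ∀ x, Measurable (f x))
    (Δ : ℝ)
    (hΔ : ∀ x x' θ, |Real.log (f x' θ) - Real.log (f x θ)| ≤ Δ)
    (ε T : ℝ) (hε : 0 < ε) (hT : T = 2 * Δ / ε)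
    (N : ℕ)
    (hZ : ∀ Y : Fin N → 𝒳,
      0 < (∫⁻ θ, ENNReal.ofReal ((∏ i, f (Y i) θ) ^ (1 / T)) ∂π) ∧
      (∫⁻ θ, ENNReal.ofReal ((∏ i, f (Y i) θ) ^ (1 / T)) ∂π) < ⊤)
    (X X' : Fin N → 𝒳)
    (hneighbor : ∃ j, X j ≠ X' j ∧ ∀ i, i ≠ j → X i = X' i)
    (S : Set Θ) (hS : MeasurableSet S) :
    (∫⁻ θ in S, ENNReal.ofReal ((∏ i, f (X i) θ) ^ (1 / T)) ∂π) /
        (∫⁻ θ, ENNReal.ofReal ((∏ i, f (X i) θ) ^ (1 / T)) ∂π) ≤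
      ENNReal.ofReal (Real.exp (2 * Δ / T)) *
        ((∫⁻ θ in S, ENNReal.ofReal ((∏ i, f (X' i) θ) ^ (1 / T)) ∂π) /
          (∫⁻ θ, ENNReal.ofReal ((∏ i, f (X' i) θ) ^ (1 / T)) ∂π)) := by
  obtain ⟨j, -, hX⟩ := hneighbor
  obtain ⟨θ⟩ : Nonempty Θ := π.nonempty_of_neZero
  have hΔ_nonneg : 0 ≤ Δ := (abs_nonneg _).trans (hΔ (X j) (X j) θ)
  have hT_nonneg : 0 ≤ T := by rw [hT]; positivity
  have exp_eq : ENNReal.ofReal (Real.exp (2 * Δ / T)) =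
      ENNReal.ofReal (Real.exp (Δ / T)) * ENNReal.ofReal (Real.exp (Δ / T)) := by
    rw [← ENNReal.ofReal_mul (Real.exp_pos _).le, ← Real.exp_add]
    congr 2
    ring
  rw [exp_eq]
  exact ENNReal.div_le_mul_mul_div (ENNReal.ofReal_pos.2 (Real.exp_pos _)).ne'
    ENNReal.ofReal_ne_top
    (lintegral_tempered_likelihood_le _ hf_pos hT_nonneg hΔ hX)
    (lintegral_tempered_likelihood_le _ hf_pos hT_nonneg hΔ fun i hi => (hX i hi).symm)
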